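/- For every dimension d ≥ 1 there is a constant c = c(d) > 0 such that for all integers p ≥ q ≥ 2 with q > c·p^{1 − 1/(2d−1)}, every finite indexed family of nonempty compact convex sets in ℝ^d with Helly number 2 (every pairwise-intersecting subfamily has a common point) that satisfies the (p,q)-property can be pierced by at most p − q + 1 points. -/

import Mathlib

/-- The `(p,q)`-property for a finite indexed family of sets. -/
def HasPQ {ι α : Type*} [Fintype ι] (F : ι → Set α) (p q : ℕ) : Prop :=
  p ≤ Fintype.card ι ∧
    ∀ J : Finset ι, J.card = p → ∃ K ⊆ J, K.card = q ∧ (⋂ k ∈ K, F k).Nonempty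

/-- `P` pierces the family `F`: every member of `F` contains a point of `P`. -/
def Pierces {ι α : Type*} (F : ι → Set α) (P : Finset α) : Prop :=
  ∀ i, ∃ x ∈ P, x ∈ F i

open Finset

/-- Every pairwise intersecting subfamily of `(F i)_{i ∈ s}` has a common point. -/
def HellyTwoOn {ι α : Type*} (F : ι → Set α) (s : Finset ι) : Prop :=
  ∀ t ⊆ s, (∀ i ∈ t, ∀ j ∈ t, (F i ∩ F j).Nonempty) → (⋂ i ∈ t, F i).Nonempty

/-- The family `(F i)_{i ∈ s}` can be pierced by at most `n` points. -/
def PiercedBy {ι α : Type*} (F : ι → Set α) (s : Finset ι) (n : ℕ) : Prop :=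
  ∃ P : Finset α, P.card ≤ n ∧ ∀ i ∈ s, ∃ x ∈ P, x ∈ F i

/-- The family `(F i)_{i ∈ s}` has at most `n` pairwise disjoint members. -/
def PackingLE {ι α : Type*} (F : ι → Set α) (s : Finset ι) (n : ℕ) : Prop :=
  ∀ t ⊆ s, (t : Set ι).PairwiseDisjoint F → t.card ≤ n

/-- The `(p,q)`-property for the family `(F i)_{i ∈ s}`. -/
def HasPQOn {ι α : Type*} (F : ι → Set α) (s : Finset ι) (p q : ℕ) : Prop :=
  p ≤ s.card ∧ ∀ J ⊆ s, J.card = p → ∃ K ⊆ J, K.card = q ∧ (⋂ k ∈ K, F k).Nonempty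

section Abstract

variable {ι α : Type*} {F : ι → Set α} {s t : Finset ι} {m n p q : ℕ}

theorem HellyTwoOn.mono (h : HellyTwoOn F s) (hts : t ⊆ s) : HellyTwoOn F t :=
  fun u hu => h u (hu.trans hts)

theorem PackingLE.mono (h : PackingLE F s n) (hts : t ⊆ s) : PackingLE F t n :=
  fun u hu => h u (hu.trans hts)

theorem PiercedBy.mono (h : PiercedBy F s n) (hts : t ⊆ s) (hn : n ≤ m) : PiercedBy F t m := by
  obtain ⟨P, hP, hPs⟩ := h
  exact ⟨P, hP.trans hn, fun i hi => hPs i (hts hi)⟩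

theorem PiercedBy.union [DecidableEq ι] (hs : PiercedBy F s n) (ht : PiercedBy F t m) :
    PiercedBy F (s ∪ t) (n + m) := by
  classical
  obtain ⟨P, hP, hPs⟩ := hs
  obtain ⟨Q, hQ, hQt⟩ := ht
  refine ⟨P ∪ Q, (card_union_le _ _).trans (by omega), fun i hi => ?_⟩
  rcases mem_union.1 hi with hi | hi
  · obtain ⟨x, hx, hxi⟩ := hPs i hi
    exact ⟨x, mem_union_left _ hx, hxi⟩
  · obtain ⟨x, hx, hxi⟩ := hQt i hi
    exact ⟨x, mem_union_right _ hx, hxi⟩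

theorem PiercedBy.biUnion [DecidableEq ι] {κ : Type*} {A : Finset κ} {g : κ → Finset ι}
    (h : ∀ a ∈ A, PiercedBy F (g a) n) : PiercedBy F (A.biUnion g) (A.card * n) := by
  classical
  choose! P hP hPs using h
  refine ⟨A.biUnion P, card_biUnion_le_card_mul _ _ _ hP, fun i hi => ?_⟩
  obtain ⟨a, ha, hia⟩ := mem_biUnion.1 hi
  obtain ⟨x, hx, hxi⟩ := hPs a ha i hia
  exact ⟨x, mem_biUnion.2 ⟨a, ha, hx⟩, hxi⟩

theorem HellyTwoOn.piercedBy_one (h : HellyTwoOn F s)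
    (hs : ∀ i ∈ s, ∀ j ∈ s, (F i ∩ F j).Nonempty) : PiercedBy F s 1 := by
  obtain ⟨x, hx⟩ := h s Subset.rfl hs
  exact ⟨{x}, by simp, fun i hi => ⟨x, mem_singleton_self x, Set.mem_iInter₂.1 hx i hi⟩⟩

theorem PackingLE.eq_empty (h : PackingLE F s 0) : s = ∅ := by
  refine eq_empty_of_forall_notMem fun i hi => ?_
  have := h {i} (singleton_subset_iff.2 hi) (by simp)
  simp at this

theorem PackingLE.inter_nonempty (h : PackingLE F s 1) (hne : ∀ i ∈ s, (F i).Nonempty)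
    {i j : ι} (hi : i ∈ s) (hj : j ∈ s) : (F i ∩ F j).Nonempty := by
  classical
  by_contra hij
  have hne' : i ≠ j := by
    rintro rfl
    exact hij (by simpa using hne i hi)
  have hd : Disjoint (F i) (F j) :=
    Set.disjoint_iff_inter_eq_empty.2 (Set.not_nonempty_iff_eq_empty.1 hij)
  have := h {i, j} (by simp [insert_subset_iff, hi, hj])
    (by
      rw [coe_pair]
      refine (Set.pairwiseDisjoint_singleton j F).insert fun k hk _ => ?_
      rwa [Set.mem_singleton_iff.1 hk])
  rw [card_pair hne'] at this
  omega

/-- A pairwise disjoint subfamily of maximum size meets every member of the family. -/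
theorem exists_maximum_packing (hne : ∀ i ∈ s, (F i).Nonempty) :
    ∃ S ⊆ s, (S : Set ι).PairwiseDisjoint F ∧ PackingLE F s S.card ∧
      ∀ k ∈ s, ∃ i ∈ S, (F i ∩ F k).Nonempty := by
  classical
  obtain ⟨S, hS, hmax⟩ := exists_max_image
    (s.powerset.filter fun t : Finset ι => (t : Set ι).PairwiseDisjoint F) card ⟨∅, by simp⟩
  simp only [mem_filter, mem_powerset, and_imp] at hS hmax
  refine ⟨S, hS.1, hS.2, hmax, fun k hk => ?_⟩
  by_contra! hcon
  have hkS : k ∉ S := fun hkS => by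
    have := hcon k hkS
    rw [Set.inter_self] at this
    exact (hne k hk).ne_empty this
  have := hmax (insert k S) (insert_subset hk hS.1) (by
    rw [coe_insert]
    exact hS.2.insert fun j hj _ => (Set.disjoint_iff_inter_eq_empty.2 (hcon j hj)).symm)
  rw [card_insert_of_notMem hkS] at this
  omega

theorem card_inter_le_one_of_common_point [DecidableEq ι] {K S : Finset ι}
    (hS : (S : Set ι).PairwiseDisjoint F) (hK : (⋂ k ∈ K, F k).Nonempty) :
    (K ∩ S).card ≤ 1 := by
  obtain ⟨x, hx⟩ := hK
  rw [Set.mem_iInter₂] at hx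
  refine card_le_one.2 fun a ha b hb => ?_
  rw [mem_inter] at ha hb
  by_contra hab
  exact Set.disjoint_left.1 (hS ha.2 hb.2 hab) (hx a ha.1) (hx b hb.1)

theorem HasPQOn.card_le (h : HasPQOn F s p q) (hq : 2 ≤ q) (hqp : q ≤ p) :
    PackingLE F s (p - q + 1) := by
  classical
  intro S hSs hS
  by_contra! hcard
  obtain ⟨T, hTS, hT⟩ := exists_subset_card_eq (s := S) (n := p - q + 2) (by omega)
  obtain ⟨J, hTJ, hJs, hJ⟩ := exists_subsuperset_card_eq (hTS.trans hSs)
    (n := p) (by omega) h.1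
  obtain ⟨K, hKJ, hK, hKne⟩ := h.2 J hJs hJ
  have h1 := card_inter_le_one_of_common_point (hS.subset (coe_subset.2 hTS)) hKne
  have h2 := card_le_card (sdiff_subset_sdiff hKJ (Subset.refl T))
  have h3 := card_sdiff_add_card_eq_card hTJ
  have h4 := card_sdiff_add_card_inter K T
  omega

theorem HasPQOn.sdiff [DecidableEq ι] (h : HasPQOn F s p q) {S : Finset ι} (hSs : S ⊆ s)
    (hS : (S : Set ι).PairwiseDisjoint F) (hSp : S.card ≤ p) :
    HasPQOn F (s \ S) (p - S.card) (q - 1) := by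
  have hsc := card_sdiff_add_card_eq_card hSs
  refine ⟨by have := h.1; omega, fun J hJ hJc => ?_⟩
  have hd : Disjoint J S := disjoint_of_subset_left hJ sdiff_disjoint
  obtain ⟨K, hKJ, hK, hKne⟩ := h.2 (J ∪ S) (union_subset (hJ.trans sdiff_subset) hSs)
    (by rw [card_union_of_disjoint hd]; omega)
  have h1 := card_inter_le_one_of_common_point hS hKne
  have h4 := card_sdiff_add_card_inter K S
  obtain ⟨L, hLK, hL⟩ := exists_subset_card_eq (s := K \ S) (n := q - 1) (by omega)
  refine ⟨L, hLK.trans fun k hk => ?_, hL, hKne.mono ?_⟩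
  · rw [mem_sdiff] at hk
    exact (mem_union.1 (hKJ hk.1)).resolve_right hk.2
  · exact Set.biInter_subset_biInter_left fun k hk => (mem_sdiff.1 (hLK hk)).1

/-- If the pairwise disjoint subfamily `S` meets every member of the family, then the points
piercing `S` can be chosen so that they make one point of a transversal of the rest redundant. -/
theorem HellyTwoOn.piercedBy_of_sdiff [DecidableEq ι] (hH : HellyTwoOn F s)
    (hne : ∀ i ∈ s, (F i).Nonempty) {S : Finset ι} (hSs : S ⊆ s)
    (hmeet : ∀ k ∈ s, ∃ i ∈ S, (F i ∩ F k).Nonempty) (h : PiercedBy F (s \ S) (n + 1)) :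
    PiercedBy F s (S.card + n) := by
  classical
  obtain ⟨K, hKs, hK, Q, hQ, hQK⟩ : ∃ K ⊆ s, (∀ i ∈ K, ∀ j ∈ K, (F i ∩ F j).Nonempty) ∧
      ∃ Q : Finset α, Q.card ≤ n ∧ ∀ i ∈ s \ S, i ∈ K ∨ ∃ x ∈ Q, x ∈ F i := by
    obtain ⟨P, hP, hPs⟩ := h
    rcases P.eq_empty_or_nonempty with rfl | ⟨x, hx⟩
    · exact ⟨∅, by simp, by simp, ∅, by simp, fun i hi => Or.inr (hPs i hi)⟩
    · refine ⟨s.filter fun i => x ∈ F i, filter_subset _ _, fun i hi j hj =>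
        ⟨x, (mem_filter.1 hi).2, (mem_filter.1 hj).2⟩, P.erase x, ?_, fun i hi => ?_⟩
      · rw [card_erase_of_mem hx]
        omega
      · obtain ⟨y, hy, hyi⟩ := hPs i hi
        by_cases hyx : y = x
        · exact Or.inl (mem_filter.2 ⟨(mem_sdiff.1 hi).1, hyx ▸ hyi⟩)
        · exact Or.inr ⟨y, mem_erase.2 ⟨hyx, hy⟩, hyi⟩
  have hpt : ∀ i ∈ S, ∃ x, x ∈ F i ∧ ∀ k ∈ K, (F i ∩ F k).Nonempty → x ∈ F k := by
    intro i hi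
    obtain ⟨x, hx⟩ := hH (insert i (K.filter fun k => (F i ∩ F k).Nonempty))
      (insert_subset (hSs hi) ((filter_subset _ _).trans hKs)) (by
        intro a ha b hb
        rcases mem_insert.1 ha with rfl | ha <;> rcases mem_insert.1 hb with rfl | hb
        · simpa using hne _ (hSs hi)
        · exact (mem_filter.1 hb).2
        · rw [Set.inter_comm]
          exact (mem_filter.1 ha).2
        · exact hK a (mem_filter.1 ha).1 b (mem_filter.1 hb).1)
    rw [Set.mem_iInter₂] at hx
    exact ⟨x, hx i (mem_insert_self _ _), fun k hk hik =>
      hx k (mem_insert_of_mem (mem_filter.2 ⟨hk, hik⟩))⟩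
  rcases S.eq_empty_or_nonempty with rfl | ⟨i₀, hi₀⟩
  · refine ⟨∅, by simp, fun k hk => ?_⟩
    obtain ⟨i, hi, -⟩ := hmeet k hk
    simp at hi
  obtain ⟨x₀, -⟩ := hne i₀ (hSs hi₀)
  have : Nonempty α := ⟨x₀⟩
  choose! x hxi hxK using hpt
  refine ⟨S.image x ∪ Q, (card_union_le _ _).trans (add_le_add card_image_le hQ),
    fun k hk => ?_⟩
  by_cases hkS : k ∈ S
  · exact ⟨x k, mem_union_left _ (mem_image_of_mem x hkS), hxi k hkS⟩
  · rcases hQK k (mem_sdiff.2 ⟨hk, hkS⟩) with hkK | ⟨y, hy, hyk⟩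
    · obtain ⟨i, hi, hik⟩ := hmeet k hk
      exact ⟨x i, mem_union_left _ (mem_image_of_mem x hi), hxK i hi k hkK hik⟩
    · exact ⟨y, mem_union_right _ hy, hyk⟩

/-- The tight bound when `q` exceeds half of `p`. -/
theorem HasPQOn.piercedBy_of_add_two_le (h : HasPQOn F s p q) (hH : HellyTwoOn F s)
    (hne : ∀ i ∈ s, (F i).Nonempty) (hq : 2 ≤ q) (hqp : q ≤ p) (hpq : p + 2 ≤ 2 * q) :
    PiercedBy F s (p - q + 1) := by
  classical
  induction p using Nat.strong_induction_on generalizing q s with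
  | _ p ih =>
    obtain ⟨S, hSs, hS, hmax, hmeet⟩ := exists_maximum_packing hne
    have hle := h.card_le hq hqp S hSs hS
    by_cases hS1 : S.card ≤ 1
    · refine (hH.piercedBy_one fun i hi j hj =>
        PackingLE.inter_nonempty (fun t ht htd => (hmax t ht htd).trans hS1) hne hi hj).mono
          Subset.rfl (by omega)
    · have := ih (p - S.card) (by omega) (h.sdiff hSs hS (by omega)) (hH.mono sdiff_subset)
        (fun i hi => hne i (mem_sdiff.1 hi).1) (by omega) (by omega) (by omega)
      rw [show p - S.card - (q - 1) + 1 = (p - q + 1 - S.card) + 1 by omega] at this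
      refine (hH.piercedBy_of_sdiff hne hSs hmeet this).mono Subset.rfl (by omega)

theorem pow_bound_of_sub {k : ℕ} (hk : 1 ≤ k) (hq : 2 ≤ q) (hn : n ≤ p)
    (h : 2 ^ (k + 2) * p ^ k ≤ q ^ (k + 1)) (hnq : 2 * p < n * q) :
    2 ^ (k + 2) * (p - n) ^ k ≤ (q - 1) ^ (k + 1) := by
  obtain ⟨r, rfl⟩ := Nat.exists_eq_add_of_le hn
  obtain ⟨a, rfl⟩ := Nat.exists_eq_add_of_le hq
  obtain ⟨j, rfl⟩ := Nat.exists_eq_add_of_le hk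
  rw [show n + r - n = r by omega, show 2 + a - 1 = a + 1 by omega]
  have h1 : (2 + a) ^ 2 * r ≤ (n + r) * (a + 1) ^ 2 := by
    nlinarith [Nat.zero_le (n * a), Nat.zero_le (r * a), Nat.zero_le n, Nat.zero_le r]
  have h2 : (2 + a) ^ (2 * (1 + j)) * r ^ (1 + j) ≤ (n + r) ^ (1 + j) * (a + 1) ^ (2 * (1 + j)) := by
    have := Nat.pow_le_pow_left h1 (1 + j)
    rwa [mul_pow, mul_pow, ← pow_mul, ← pow_mul] at this
  have h3 : (a + 1) ^ j ≤ (2 + a) ^ j := Nat.pow_le_pow_left (by omega) j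
  have hpos : 0 < (2 + a) ^ (2 * (1 + j)) := by positivity
  refine Nat.le_of_mul_le_mul_left ?_ hpos
  calc (2 + a) ^ (2 * (1 + j)) * (2 ^ (1 + j + 2) * r ^ (1 + j))
      = 2 ^ (1 + j + 2) * ((2 + a) ^ (2 * (1 + j)) * r ^ (1 + j)) := by ring
    _ ≤ 2 ^ (1 + j + 2) * ((n + r) ^ (1 + j) * (a + 1) ^ (2 * (1 + j))) := by gcongr
    _ = (2 ^ (1 + j + 2) * (n + r) ^ (1 + j)) * (a + 1) ^ (2 * (1 + j)) := by ring
    _ ≤ (2 + a) ^ (1 + j + 1) * (a + 1) ^ (2 * (1 + j)) := by gcongr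
    _ = (2 + a) ^ (1 + j + 1) * (a + 1) ^ j * (a + 1) ^ (1 + j + 1) := by ring
    _ ≤ (2 + a) ^ (1 + j + 1) * (2 + a) ^ j * (a + 1) ^ (1 + j + 1) := by gcongr
    _ = (2 + a) ^ (2 * (1 + j)) * (a + 1) ^ (1 + j + 1) := by ring

/-- A polynomial `(p,2)`-theorem for a family with Helly number two implies a tight
`(p,q)`-theorem. -/
theorem HasPQOn.piercedBy_of_packing_bound {k : ℕ} (h : HasPQOn F s p q) (hH : HellyTwoOn F s)
    (hne : ∀ i ∈ s, (F i).Nonempty)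
    (hpack : ∀ t ⊆ s, ∀ n, PackingLE F t n → PiercedBy F t (n ^ (k + 1)))
    (hq : 2 ≤ q) (hqp : q ≤ p) (hpq : 2 ^ (k + 2) * p ^ k ≤ q ^ (k + 1)) :
    PiercedBy F s (p - q + 1) := by
  classical
  rcases Nat.eq_zero_or_pos k with rfl | hk
  · simpa using hpack s Subset.rfl _ (h.card_le hq hqp)
  induction p using Nat.strong_induction_on generalizing q s with
  | _ p ih =>
    obtain ⟨S, hSs, hS, hmax, hmeet⟩ := exists_maximum_packing hne
    have hle := h.card_le hq hqp S hSs hS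
    by_cases hlarge : p + 2 ≤ 2 * q
    · exact h.piercedBy_of_add_two_le hH hne hq hqp hlarge
    have hp : 0 < p := by omega
    have hq2 : 2 < q := by
      by_contra hq2
      obtain rfl : q = 2 := by omega
      have h1 : 1 ≤ p ^ k := Nat.one_le_pow _ _ hp
      have h2 : 0 < 2 ^ (k + 1) := by positivity
      rw [pow_succ 2 (k + 1)] at hpq
      nlinarith
    by_cases hsmall : S.card * q ≤ 2 * p
    · refine (hpack s Subset.rfl _ hmax).mono Subset.rfl ?_
      have h1 : 2 * S.card ^ (k + 1) ≤ p := by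
        have hpos : 0 < 2 ^ (k + 1) * p ^ k := by positivity
        refine Nat.le_of_mul_le_mul_left ?_ hpos
        calc 2 ^ (k + 1) * p ^ k * (2 * S.card ^ (k + 1))
            = S.card ^ (k + 1) * (2 ^ (k + 2) * p ^ k) := by ring
          _ ≤ S.card ^ (k + 1) * q ^ (k + 1) := by gcongr
          _ = (S.card * q) ^ (k + 1) := by ring
          _ ≤ (2 * p) ^ (k + 1) := by gcongr
          _ = 2 ^ (k + 1) * p ^ k * p := by ring
      omega
    · have hSpos : 0 < S.card := by
        by_contra h0
        obtain h0 : S.card = 0 := by omega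
        simp [h0] at hsmall
      have := ih (p - S.card) (by omega) (h.sdiff hSs hS (by omega)) (hH.mono sdiff_subset)
        (fun i hi => hne i (mem_sdiff.1 hi).1) (fun t ht => hpack t (ht.trans sdiff_subset))
        (by omega) (by omega) (pow_bound_of_sub hk hq (by omega) hpq (by omega))
      rw [show p - S.card - (q - 1) + 1 = (p - q + 1 - S.card) + 1 by omega] at this
      exact (hH.piercedBy_of_sdiff hne hSs hmeet this).mono Subset.rfl (by omega)

end Abstract

section Convex

variable {ι E : Type*} [NormedAddCommGroup E] [NormedSpace ℝ E] {F : ι → Set E} {s : Finset ι}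
  {n : ℕ}

/-- Compact convex sets on a line are pierced by as many points as there are pairwise disjoint
members. -/
theorem PackingLE.piercedBy_of_injOn (f : E →L[ℝ] ℝ) (hne : ∀ i ∈ s, (F i).Nonempty)
    (hcomp : ∀ i ∈ s, IsCompact (F i)) (hconv : ∀ i ∈ s, Convex ℝ (F i))
    (hinj : Set.InjOn f (⋃ i ∈ s, F i)) (h : PackingLE F s n) : PiercedBy F s n := by
  classical
  induction n generalizing s with
  | zero => exact ⟨∅, by simp, by simp [h.eq_empty]⟩
  | succ n ih =>
    rcases s.eq_empty_or_nonempty with rfl | hs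
    · exact ⟨∅, by simp, by simp⟩
    have hmax : ∀ i ∈ s, ∃ x ∈ F i, ∀ y ∈ F i, f y ≤ f x := fun i hi =>
      (hcomp i hi).exists_isMaxOn (hne i hi) f.continuous.continuousOn
    choose! x hx hxmax using hmax
    obtain ⟨i₀, hi₀, hmin⟩ := exists_min_image s (fun i => f (x i)) hs
    have hdisj : ∀ j ∈ s, x i₀ ∉ F j → Disjoint (F i₀) (F j) := by
      intro j hj hxj
      refine Set.disjoint_left.2 fun y hy hyj => hxj ?_
      obtain ⟨z, hz, hfz⟩ :=
        ((hconv j hj).isPreconnected.image f f.continuous.continuousOn).ordConnected.out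
        ⟨y, hyj, rfl⟩ ⟨x j, hx j hj, rfl⟩ ⟨hxmax i₀ hi₀ y hy, hmin j hj⟩
      rwa [← hinj (Set.mem_biUnion hj hz) (Set.mem_biUnion hi₀ (hx i₀ hi₀)) hfz]
    have hsub : (s.filter fun j => x i₀ ∉ F j) ⊆ s := filter_subset _ _
    obtain ⟨P, hP, hPs⟩ := ih (s := s.filter fun j => x i₀ ∉ F j)
      (fun i hi => hne i (hsub hi)) (fun i hi => hcomp i (hsub hi))
      (fun i hi => hconv i (hsub hi)) (hinj.mono (Set.biUnion_mono hsub fun _ _ => le_rfl)) (by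
        intro t ht htd
        have hi₀t : i₀ ∉ t := fun hmem => (mem_filter.1 (ht hmem)).2 (hx i₀ hi₀)
        have := h (insert i₀ t) (insert_subset hi₀ (ht.trans hsub)) (by
          rw [coe_insert]
          exact htd.insert fun j hj _ =>
            hdisj j (hsub (ht hj)) (mem_filter.1 (ht hj)).2)
        rw [card_insert_of_notMem hi₀t] at this
        omega)
    refine ⟨insert (x i₀) P, (card_insert_le _ _).trans (by omega), fun j hj => ?_⟩
    by_cases hxj : x i₀ ∈ F j
    · exact ⟨x i₀, mem_insert_self _ _, hxj⟩
    · obtain ⟨y, hy, hyj⟩ := hPs j (mem_filter.2 ⟨hj, hxj⟩)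
      exact ⟨y, mem_insert_of_mem hy, hyj⟩

theorem Convex.inter_level_nonempty {A B C : Set E} (f : E →L[ℝ] ℝ) {c : ℝ} (hC : Convex ℝ C)
    (hA : ∀ a ∈ A, f a < c) (hB : ∀ b ∈ B, c < f b) (hCA : (A ∩ C).Nonempty)
    (hCB : (B ∩ C).Nonempty) : (C ∩ {x | f x = c}).Nonempty := by
  obtain ⟨a, haA, haC⟩ := hCA
  obtain ⟨b, hbB, hbC⟩ := hCB
  obtain ⟨z, hz, hfz⟩ := (hC.isPreconnected.image f f.continuous.continuousOn).ordConnected.out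
    ⟨a, haC, rfl⟩ ⟨b, hbC, rfl⟩ ⟨(hA a haA).le, (hB b hbB).le⟩
  exact ⟨z, hz, hfz⟩

theorem HellyTwoOn.inter_level {i j : ι} {t : Finset ι} (hH : HellyTwoOn F s) (hi : i ∈ s)
    (hj : j ∈ s) (hne : ∀ i ∈ s, (F i).Nonempty) (hts : t ⊆ s)
    (hconv : ∀ k ∈ t, Convex ℝ (F k)) (hti : ∀ k ∈ t, (F i ∩ F k).Nonempty)
    (htj : ∀ k ∈ t, (F j ∩ F k).Nonempty) (f : E →L[ℝ] ℝ) {c : ℝ} (hfi : ∀ a ∈ F i, f a < c)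
    (hfj : ∀ b ∈ F j, c < f b) (ht : ∀ k ∈ t, ∀ l ∈ t, (F k ∩ F l).Nonempty) :
    ((⋂ k ∈ t, F k) ∩ {x | f x = c}).Nonempty := by
  classical
  have key : ∀ a ∈ s, (∀ k ∈ t, (F a ∩ F k).Nonempty) → (F a ∩ ⋂ k ∈ t, F k).Nonempty := by
    intro a ha hat
    have := hH (insert a t) (insert_subset ha hts) (by
      intro k hk l hl
      rcases mem_insert.1 hk with rfl | hkt <;> rcases mem_insert.1 hl with rfl | hlt
      · simpa using hne _ ha
      · exact hat l hlt
      · rw [Set.inter_comm]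
        exact hat k hkt
      · exact ht k hkt l hlt)
    rwa [set_biInter_insert] at this
  exact Convex.inter_level_nonempty f (convex_iInter₂ hconv) hfi hfj (key i hi hti) (key j hj htj)

/-- A polynomial `(p,2)`-theorem for compact convex sets with Helly number two. -/
theorem PackingLE.piercedBy_pow [FiniteDimensional ℝ E] (d : ℕ) (W : Submodule ℝ E)
    (hW : Module.finrank ℝ W ≤ d + 1) (x₀ : E) (hFW : ∀ i ∈ s, ∀ y ∈ F i, y - x₀ ∈ W)
    (hne : ∀ i ∈ s, (F i).Nonempty) (hcomp : ∀ i ∈ s, IsCompact (F i))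
    (hconv : ∀ i ∈ s, Convex ℝ (F i)) (hH : HellyTwoOn F s) (h : PackingLE F s n) :
    PiercedBy F s (n ^ (2 * d + 1)) := by
  classical
  induction d generalizing W x₀ F s with
  | zero =>
    obtain ⟨v, hv⟩ := finrank_le_one_iff.1 (by simpa using hW)
    obtain ⟨f, hf⟩ : ∃ f : E →L[ℝ] ℝ, (v : E) ≠ 0 → f v ≠ 0 := by
      by_cases hv0 : (v : E) = 0
      · exact ⟨0, fun h => absurd hv0 h⟩
      · obtain ⟨f, hf⟩ := SeparatingDual.exists_ne_zero (R := ℝ) hv0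
        exact ⟨f, fun _ => hf⟩
    have : PiercedBy F s n := h.piercedBy_of_injOn f hne hcomp hconv (by
      intro x hx y hy hxy
      obtain ⟨i, hi, hxi⟩ := Set.mem_iUnion₂.1 hx
      obtain ⟨j, hj, hyj⟩ := Set.mem_iUnion₂.1 hy
      have hmem : x - y ∈ W := by
        have := W.sub_mem (hFW i hi x hxi) (hFW j hj y hyj)
        rwa [sub_sub_sub_cancel_right] at this
      obtain ⟨r, hr⟩ := hv ⟨x - y, hmem⟩
      have hr' : r • (v : E) = x - y := congrArg Subtype.val hr
      have hfr : r * f v = 0 := by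
        rw [← smul_eq_mul, ← map_smul, hr', map_sub, hxy, sub_self]
      refine sub_eq_zero.1 ?_
      rw [← hr']
      by_cases hv0 : (v : E) = 0
      · rw [hv0, smul_zero]
      · rw [(mul_eq_zero.1 hfr).resolve_right (hf hv0), zero_smul])
    simpa using this
  | succ d ih =>
    obtain ⟨A, hAs, hA, hAmax, hAmeet⟩ := exists_maximum_packing hne
    have hAn := h A hAs hA
    have hone : ∀ i ∈ A, PiercedBy F (s.filter fun k => (F i ∩ F k).Nonempty ∧
        ∀ j ∈ A, j ≠ i → Disjoint (F j) (F k)) 1 := by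
      intro i hi
      refine (hH.mono (filter_subset _ _)).piercedBy_one fun k hk l hl => ?_
      simp only [mem_filter] at hk hl
      by_contra hkl
      have hkl' : Disjoint (F k) (F l) :=
        Set.disjoint_iff_inter_eq_empty.2 (Set.not_nonempty_iff_eq_empty.1 hkl)
      have hnot : ∀ a ∈ s, (∀ j ∈ A, j ≠ i → Disjoint (F j) (F a)) → a ∉ A.erase i := by
        intro a ha had hmem
        have := had a (mem_of_mem_erase hmem) (ne_of_mem_erase hmem)
        exact (hne a ha).ne_empty (disjoint_self.1 this)
      have hne' : k ≠ l := by
        rintro rfl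
        exact (hne k hk.1).ne_empty (disjoint_self.1 hkl')
      have hcard := hAmax (insert k (insert l (A.erase i)))
        (insert_subset hk.1 (insert_subset hl.1 ((erase_subset _ _).trans hAs))) (by
          rw [coe_insert, coe_insert]
          refine ((hA.subset (coe_subset.2 (erase_subset i A))).insert fun j hj _ => ?_).insert
            fun j hj _ => ?_
          · have hj' := mem_erase.1 (mem_coe.1 hj)
            exact (hl.2.2 j hj'.2 hj'.1).symm
          · rcases hj with rfl | hj
            · exact hkl'
            · have hj' := mem_erase.1 (mem_coe.1 hj)
              exact (hk.2.2 j hj'.2 hj'.1).symm)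
      rw [card_insert_of_notMem (by
          rw [mem_insert, not_or]
          exact ⟨hne', hnot k hk.1 hk.2.2⟩),
        card_insert_of_notMem (hnot l hl.1 hl.2.2), card_erase_of_mem hi] at hcard
      have := card_pos.2 ⟨i, hi⟩
      omega
    have hpair : ∀ a ∈ A.offDiag, PiercedBy F (s.filter fun k => (F a.1 ∩ F k).Nonempty ∧
        (F a.2 ∩ F k).Nonempty) (n ^ (2 * d + 1)) := by
      rintro ⟨i, j⟩ hij
      simp only [mem_offDiag] at hij
      obtain ⟨hi, hj, hij⟩ := hij
      obtain ⟨f, u, c, hu, huc, hc⟩ := geometric_hahn_banach_compact_closed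
        (hconv i (hAs hi)) (hcomp i (hAs hi)) (hconv j (hAs hj)) (hcomp j (hAs hj)).isClosed
        (hA hi hj hij)
      have hfi : ∀ a ∈ F i, f a < c := fun a ha => (hu a ha).trans huc
      set t := s.filter fun k => (F i ∩ F k).Nonempty ∧ (F j ∩ F k).Nonempty with ht
      have hts : t ⊆ s := filter_subset _ _
      have hlevel : ∀ r ⊆ t, (∀ k ∈ r, ∀ l ∈ r, (F k ∩ F l).Nonempty) →
          ((⋂ k ∈ r, F k) ∩ {x | f x = c}).Nonempty := fun r hr hrr =>
        hH.inter_level (hAs hi) (hAs hj) hne (hr.trans hts)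
          (fun k hk => hconv k (hts (hr hk))) (fun k hk => (mem_filter.1 (hr hk)).2.1)
          (fun k hk => (mem_filter.1 (hr hk)).2.2) f hfi hc hrr
      have hlevel₂ : ∀ k ∈ t, ∀ l ∈ t, (F k ∩ F l).Nonempty →
          ((F k ∩ {x | f x = c}) ∩ (F l ∩ {x | f x = c})).Nonempty := by
        intro k hk l hl hkl
        obtain ⟨x, hx, hxc⟩ := hlevel {k, l} (by simp [insert_subset_iff, hk, hl]) (by
          have hk' := hne k (hts hk)
          have hl' := hne l (hts hl)
          simp [hkl, hk', hl', Set.inter_comm (F l) (F k)])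
        rw [Set.mem_iInter₂] at hx
        exact ⟨x, ⟨hx k (by simp), hxc⟩, ⟨hx l (by simp), hxc⟩⟩
      have hne' : ∀ k ∈ t, (F k ∩ {x | f x = c}).Nonempty := fun k hk => by
        simpa using hlevel₂ k hk k hk (by simpa using hne k (hts hk))
      rcases t.eq_empty_or_nonempty with ht0 | ⟨k₀, hk₀⟩
      · exact ⟨∅, by simp, by simp [ht0]⟩
      obtain ⟨x₁, hx₁, hx₁c⟩ := hne' k₀ hk₀
      have hdim : Module.finrank ℝ (W ⊓ LinearMap.ker f.toLinearMap : Submodule ℝ E) ≤ d + 1 := by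
        have hlt : W ⊓ LinearMap.ker f.toLinearMap < W := by
          refine lt_of_le_of_ne inf_le_left fun heq => ?_
          obtain ⟨a, ha⟩ := hne i (hAs hi)
          obtain ⟨b, hb⟩ := hne j (hAs hj)
          have hmem : b - a ∈ W := by
            have := W.sub_mem (hFW j (hAs hj) b hb) (hFW i (hAs hi) a ha)
            rwa [sub_sub_sub_cancel_right] at this
          rw [← heq] at hmem
          have h0 : f (b - a) = 0 := hmem.2
          rw [map_sub] at h0
          linarith [hfi a ha, hc b hb]
        have := Submodule.finrank_lt_finrank_of_lt hlt
        omega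
      obtain ⟨P, hP, hPt⟩ := ih (F := fun k => F k ∩ {x | f x = c}) (s := t)
        (W ⊓ LinearMap.ker f.toLinearMap) hdim x₁
        (by
          rintro k hk y ⟨hy, hyc⟩
          refine ⟨?_, ?_⟩
          · have := W.sub_mem (hFW k (hts hk) y hy) (hFW k₀ (hts hk₀) x₁ hx₁)
            rwa [sub_sub_sub_cancel_right] at this
          · change f (y - x₁) = 0
            rw [map_sub, sub_eq_zero]
            exact hyc.trans hx₁c.symm)
        hne'
        (fun k hk => (hcomp k (hts hk)).inter_right (isClosed_eq f.continuous continuous_const))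
        (fun k hk => (hconv k (hts hk)).inter (convex_hyperplane f.toLinearMap.isLinear c))
        (by
          intro r hr hrr
          obtain ⟨x, hx, hxc⟩ := hlevel r hr fun k hk l hl =>
            (hrr k hk l hl).mono (Set.inter_subset_inter Set.inter_subset_left
              Set.inter_subset_left)
          rw [Set.mem_iInter₂] at hx
          exact ⟨x, Set.mem_iInter₂.2 fun k hk => ⟨hx k hk, hxc⟩⟩)
        (by
          intro r hr hrd
          refine h r (hr.trans hts) fun k hk l hl hkl => ?_
          refine Set.disjoint_iff_inter_eq_empty.2 (Set.not_nonempty_iff_eq_empty.1 fun hmeet => ?_)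
          exact Set.not_disjoint_iff_nonempty_inter.2
            (hlevel₂ k (hr hk) l (hr hl) hmeet) (hrd hk hl hkl))
      exact ⟨P, hP, fun k hk => (hPt k hk).imp fun x hx => ⟨hx.1, hx.2.1⟩⟩
    refine ((PiercedBy.biUnion hone).union (PiercedBy.biUnion hpair)).mono (fun k hk => ?_) ?_
    · obtain ⟨i, hi, hik⟩ := hAmeet k hk
      by_cases hex : ∃ j ∈ A, j ≠ i ∧ (F j ∩ F k).Nonempty
      · obtain ⟨j, hj, hji, hjk⟩ := hex
        exact mem_union_right _ (mem_biUnion.2 ⟨(i, j), mem_offDiag.2 ⟨hi, hj, hji.symm⟩,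
          mem_filter.2 ⟨hk, hik, hjk⟩⟩)
      · push Not at hex
        exact mem_union_left _ (mem_biUnion.2 ⟨i, hi, mem_filter.2 ⟨hk, hik, fun j hj hji =>
          Set.disjoint_iff_inter_eq_empty.2 (hex j hj hji)⟩⟩)
    · rw [offDiag_card, mul_one]
      rcases Nat.eq_zero_or_pos n with rfl | hn
      · have : A.card = 0 := by omega
        simp [this]
      · have hpow : 1 ≤ n ^ (2 * d + 1) := Nat.one_le_pow _ _ hn
        have hAA : A.card ≤ A.card * A.card := Nat.le_mul_self _
        calc A.card + (A.card * A.card - A.card) * n ^ (2 * d + 1)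
            ≤ A.card * n ^ (2 * d + 1) + (A.card * A.card - A.card) * n ^ (2 * d + 1) := by
              gcongr
              exact Nat.le_mul_of_pos_right _ hpow
          _ = A.card * A.card * n ^ (2 * d + 1) := by
              rw [← add_mul, Nat.add_sub_cancel' hAA]
          _ ≤ n * n * n ^ (2 * d + 1) := by gcongr
          _ = n ^ (2 * (d + 1) + 1) := by ring

end Convex

theorem pow_le_pow_of_mul_rpow_lt {k p q : ℕ}
    (h : 4 * (p : ℝ) ^ ((k : ℝ) / (k + 1)) < q) : 2 ^ (k + 2) * p ^ k ≤ q ^ (k + 1) := by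
  have h1 : (4 * (p : ℝ) ^ ((k : ℝ) / (k + 1))) ^ (k + 1) ≤ (q : ℝ) ^ (k + 1) := by gcongr
  have h2 : ((p : ℝ) ^ ((k : ℝ) / (k + 1))) ^ (k + 1) = (p : ℝ) ^ k := by
    rw [← Real.rpow_natCast, ← Real.rpow_mul (by positivity)]
    push_cast
    rw [div_mul_cancel₀ _ (by positivity), Real.rpow_natCast]
  rw [mul_pow, h2] at h1
  have h3 : 4 ^ (k + 1) * p ^ k ≤ q ^ (k + 1) := by exact_mod_cast h1
  refine le_trans (Nat.mul_le_mul_right _ ?_) h3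
  rw [show 4 = 2 ^ 2 by norm_num, ← pow_mul]
  exact Nat.pow_le_pow_right (by norm_num) (by omega)

/-- Theorem 1.7 (second part): for every `d ≥ 1` there is `c = c(d) > 0` so that
every finite family of nonempty compact convex sets in `ℝ^d` with Helly number 2
satisfying the `(p,q)`-property with `q > c·p^(1 - 1/(2d-1))` can be pierced by
`p - q + 1` points. -/
theorem helly2_tight_pq (d : ℕ) (hd : 1 ≤ d) :
    ∃ c : ℝ, 0 < c ∧
      ∀ (ι : Type) [Fintype ι], ∀ F : ι → Set (Fin d → ℝ),
        (∀ i, (F i).Nonempty) →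
        (∀ i, IsCompact (F i)) →
        (∀ i, Convex ℝ (F i)) →
        (∀ S : Finset ι,
          (∀ i ∈ S, ∀ j ∈ S, (F i ∩ F j).Nonempty) → (⋂ i ∈ S, F i).Nonempty) →
        ∀ p q : ℕ, 2 ≤ q → q ≤ p →
          c * (p : ℝ) ^ ((1 : ℝ) - 1 / (2 * (d : ℝ) - 1)) < (q : ℝ) →
          HasPQ F p q →
          ∃ P : Finset (Fin d → ℝ), P.card ≤ p - q + 1 ∧ Pierces F P := by
  classical
  obtain ⟨d, rfl⟩ := Nat.exists_eq_add_of_le' hd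
  refine ⟨4, by norm_num, fun ι _ F hne hcomp hconv hH p q hq hqp hpq h => ?_⟩
  have hexp : (1 : ℝ) - 1 / (2 * ((d + 1 : ℕ) : ℝ) - 1) = ((2 * d : ℕ) : ℝ) / ((2 * d : ℕ) + 1) := by
    push_cast
    have h0 : (2 * (d : ℝ) + 1) ≠ 0 := by positivity
    rw [show 2 * ((d : ℝ) + 1) - 1 = 2 * d + 1 by ring]
    field_simp
    ring
  rw [hexp] at hpq
  have hHelly : HellyTwoOn F univ := fun t _ ht => hH t ht
  have hPQ : HasPQOn F univ p q := ⟨h.1, fun J _ hJ => h.2 J hJ⟩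
  obtain ⟨P, hP, hPF⟩ := hPQ.piercedBy_of_packing_bound hHelly (fun i _ => hne i)
    (fun t ht n hn => hn.piercedBy_pow d ⊤ (by simp) 0 (by simp) (fun i _ => hne i)
      (fun i _ => hcomp i) (fun i _ => hconv i) (hHelly.mono ht))
    hq hqp (pow_le_pow_of_mul_rpow_lt hpq)
  exact ⟨P, hP, fun i => hPF i (mem_univ i)⟩
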